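/- Let μ ∈ ℝ, σ > 0 and ρ > 0, and let q(x) = 2 φ_{μ,σ²}(x) Φ((x - μ)/√(σ² + ρ²)). Then the variance of the distribution with density q equals σ² [1 - 2σ²/(π(2σ² + ρ²))]; that is, ∫ x² q(x) dx - (∫ x q(x) dx)² = σ² [1 - 2σ²/(π(2σ² + ρ²))]. -/

import Mathlib

open MeasureTheory Real

/-- The density of the standard normal distribution. -/
noncomputable def stdGaussianPDF (x : ℝ) : ℝ :=
  (Real.sqrt (2 * Real.pi))⁻¹ * Real.exp (-x ^ 2 / 2)

/-- The cumulative distribution function of the standard normal distribution. -/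
noncomputable def stdGaussianCDF (x : ℝ) : ℝ :=
  ∫ t in Set.Iic x, stdGaussianPDF t

/-- The density of the normal distribution with mean `μ` and variance `σ²`. -/
noncomputable def normalPDF (μ σ : ℝ) (x : ℝ) : ℝ :=
  (σ * Real.sqrt (2 * Real.pi))⁻¹ * Real.exp (-(x - μ) ^ 2 / (2 * σ ^ 2))

lemma aux_pdf_int : Integrable stdGaussianPDF := by
  have h := (integrable_exp_neg_mul_sq (b := 1/2) (by norm_num)).const_mul (Real.sqrt (2 * Real.pi))⁻¹
  refine h.congr (Filter.Eventually.of_forall fun x => ?_)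
  simp only [stdGaussianPDF]
  congr 2; ring

lemma aux_pdf_one : ∫ x, stdGaussianPDF x = 1 := by
  have h := integral_gaussian (1/2)
  have e : stdGaussianPDF = fun x => (Real.sqrt (2 * Real.pi))⁻¹ * Real.exp (-(1/2) * x ^ 2) := by
    ext x; simp only [stdGaussianPDF]; congr 2; ring
  rw [e, integral_const_mul, h]
  have : Real.pi / (1/2) = 2 * Real.pi := by ring
  rw [this]
  have : 0 < Real.sqrt (2 * Real.pi) := by positivity
  field_simp

lemma aux_pdf_cont : Continuous stdGaussianPDF := by
  unfold stdGaussianPDF; fun_prop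

lemma aux_pdf_nonneg (x : ℝ) : 0 ≤ stdGaussianPDF x := by
  unfold stdGaussianPDF; positivity

lemma aux_cdf_nonneg (x : ℝ) : 0 ≤ stdGaussianCDF x :=
  integral_nonneg fun t => aux_pdf_nonneg t

lemma aux_cdf_neg (x : ℝ) : stdGaussianCDF x + stdGaussianCDF (-x) = 1 := by
  have h1 : stdGaussianCDF (-x) = ∫ t in Set.Ioi x, stdGaussianPDF t := by
    have := integral_comp_neg_Ioi x stdGaussianPDF
    rw [stdGaussianCDF, ← this]
    congr 1; ext t; simp [stdGaussianPDF]
  rw [h1, stdGaussianCDF, ← aux_pdf_one]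
  exact intervalIntegral.integral_Iic_add_Ioi aux_pdf_int.integrableOn aux_pdf_int.integrableOn

lemma aux_cdf_le (x : ℝ) : stdGaussianCDF x ≤ 1 := by
  linarith [aux_cdf_neg x, aux_cdf_nonneg (-x)]

lemma aux_cdf_deriv (x : ℝ) : HasDerivAt stdGaussianCDF (stdGaussianPDF x) x := by
  have e : stdGaussianCDF = fun x => stdGaussianCDF 0 + ∫ t in (0:ℝ)..x, stdGaussianPDF t := by
    ext y
    have := intervalIntegral.integral_Iic_sub_Iic (a := 0) (b := y) aux_pdf_int.integrableOn aux_pdf_int.integrableOn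
    simp only [stdGaussianCDF]; linarith
  rw [e]
  exact (aux_pdf_cont.integral_hasStrictDerivAt 0 x).hasDerivAt.const_add _

lemma aux_cdf_cont : Continuous stdGaussianCDF :=
  continuous_iff_continuousAt.2 fun x => (aux_cdf_deriv x).continuousAt

lemma aux_int_pow (b : ℝ) (hb : 0 < b) (n : ℕ) :
    Integrable fun x : ℝ => x ^ n * Real.exp (-b * x ^ 2) := by
  have := integrable_rpow_mul_exp_neg_mul_sq hb (s := n) (by have := n.cast_nonneg (α := ℝ); linarith)
  simpa using this

lemma aux_int_cdf (c : ℝ) (f : ℝ → ℝ) (hf : Integrable f) :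
    Integrable fun x : ℝ => f x * stdGaussianCDF (c * x) := by
  refine hf.mul_bdd (c := 1) ?_ ?_
  · exact (aux_cdf_cont.comp (by fun_prop)).aestronglyMeasurable
  · refine Filter.Eventually.of_forall fun x => ?_
    rw [Real.norm_eq_abs, abs_of_nonneg (aux_cdf_nonneg _)]
    exact aux_cdf_le _

lemma aux_even (c : ℝ) (f : ℝ → ℝ) (hf : Integrable f) (he : ∀ x, f (-x) = f x) :
    2 * ∫ x, f x * stdGaussianCDF (c * x) = ∫ x, f x := by
  have h := integral_neg_eq_self (fun x => f x * stdGaussianCDF (c * x)) volume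
  have hi := aux_int_cdf c f hf
  rw [two_mul]
  nth_rewrite 1 [← h]
  rw [← integral_add hi.comp_neg hi]
  congr 1; ext x
  have := aux_cdf_neg (c * x)
  rw [he, mul_neg, ← mul_add, add_comm, this, mul_one]

lemma aux_exp_deriv (b : ℝ) (hb : 0 < b) (x : ℝ) :
    HasDerivAt (fun x => -(2 * b)⁻¹ * Real.exp (-b * x ^ 2)) (x ^ 1 * Real.exp (-b * x ^ 2)) x := by
  have h := (((hasDerivAt_pow 2 x).const_mul (-b)).exp).const_mul (-(2 * b)⁻¹)
  refine h.congr_deriv ?_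
  have : (2 * b)⁻¹ * (2 * b) = 1 := inv_mul_cancel₀ (by positivity)
  push_cast
  linear_combination (x * Real.exp (-b * x ^ 2)) * this

lemma aux_second (b : ℝ) (hb : 0 < b) :
    ∫ x : ℝ, x ^ 2 * Real.exp (-b * x ^ 2) = (2 * b)⁻¹ * ∫ x : ℝ, Real.exp (-b * x ^ 2) := by
  have i0 := aux_int_pow b hb 0
  have i1 := aux_int_pow b hb 1
  have i2 := aux_int_pow b hb 2
  have h := integral_mul_deriv_eq_deriv_mul_of_integrable (u := fun x : ℝ => x) (u' := fun _ => 1)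
    (fun x _ => hasDerivAt_id x) (fun x _ => aux_exp_deriv b hb x)
    (i2.congr (Filter.Eventually.of_forall fun x => by simp; ring))
    ((i0.const_mul (-(2 * b)⁻¹)).congr (Filter.Eventually.of_forall fun x => by simp))
    ((i1.const_mul (-(2 * b)⁻¹)).congr (Filter.Eventually.of_forall fun x => by simp; ring))
  have e : (fun x : ℝ => x ^ 2 * Real.exp (-b * x ^ 2)) = fun x => x * (x ^ 1 * Real.exp (-b * x ^ 2)) := by
    ext x; ring
  rw [e, h, ← integral_const_mul, ← integral_neg]
  congr 1; ext x; ring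

lemma aux_first (b c : ℝ) (hb : 0 < b) :
    ∫ x : ℝ, (x ^ 1 * Real.exp (-b * x ^ 2)) * stdGaussianCDF (c * x)
      = (2 * b)⁻¹ * c * (Real.sqrt (2 * Real.pi))⁻¹ * Real.sqrt (Real.pi / (b + c ^ 2 / 2)) := by
  have hb2 : 0 < b + c ^ 2 / 2 := by positivity
  have i0 := aux_int_pow b hb 0
  have i1 := aux_int_pow b hb 1
  have j0 := aux_int_pow (b + c ^ 2 / 2) hb2 0
  have key : ∀ x, Real.exp (-b * x ^ 2) * stdGaussianPDF (c * x)
      = (Real.sqrt (2 * Real.pi))⁻¹ * Real.exp (-(b + c ^ 2 / 2) * x ^ 2) := by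
    intro x
    simp only [stdGaussianPDF]
    rw [mul_left_comm, ← Real.exp_add]
    congr 2; ring
  have h := integral_mul_deriv_eq_deriv_mul_of_integrable
    (u := fun x : ℝ => stdGaussianCDF (c * x)) (u' := fun x => stdGaussianPDF (c * x) * c)
    (fun x _ => by
      have := (aux_cdf_deriv (c * x)).comp x ((hasDerivAt_id x).const_mul c)
      simpa [Function.comp_def] using this) (fun x _ => aux_exp_deriv b hb x)
    ((aux_int_cdf c _ i1).congr (Filter.Eventually.of_forall fun x => by simp; ring))
    ((j0.const_mul (-(2 * b)⁻¹ * c * (Real.sqrt (2 * Real.pi))⁻¹)).congr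
      (Filter.Eventually.of_forall fun x => by
        have := key x
        simp only [Pi.mul_apply, pow_zero, one_mul]
        linear_combination ((2 * b)⁻¹ * c) * this))
    (((aux_int_cdf c _ i0).const_mul (-(2 * b)⁻¹)).congr
      (Filter.Eventually.of_forall fun x => by simp; ring))
  rw [← integral_gaussian, ← integral_const_mul]
  calc _ = ∫ x : ℝ, stdGaussianCDF (c * x) * (x ^ 1 * Real.exp (-b * x ^ 2)) := by
        congr 1; ext x; ring
    _ = _ := by
        rw [h, ← integral_neg]
        congr 1; ext x
        linear_combination ((2 * b)⁻¹ * c) * key x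

/-- The variance of the density `q(x) = 2 φ_{μ,σ²}(x) Φ((x-μ)/√(σ²+ρ²))` is
`σ² [1 - 2σ²/(π(2σ²+ρ²))]`. -/
theorem winner_density_variance (μ σ ρ : ℝ) (hσ : 0 < σ) (hρ : 0 < ρ) :
    (∫ x, x ^ 2 * (2 * normalPDF μ σ x
          * stdGaussianCDF ((x - μ) / Real.sqrt (σ ^ 2 + ρ ^ 2))))
      - (∫ x, x * (2 * normalPDF μ σ x
          * stdGaussianCDF ((x - μ) / Real.sqrt (σ ^ 2 + ρ ^ 2)))) ^ 2
      = σ ^ 2 * (1 - 2 * σ ^ 2 / (Real.pi * (2 * σ ^ 2 + ρ ^ 2))) := by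
  set s := Real.sqrt (σ ^ 2 + ρ ^ 2) with hs
  have hs0 : 0 < s := by positivity
  have hs2 : s ^ 2 = σ ^ 2 + ρ ^ 2 := Real.sq_sqrt (by positivity)
  obtain ⟨b, hbd⟩ : ∃ b, b = (2 * σ ^ 2)⁻¹ := ⟨_, rfl⟩
  have hb : 0 < b := by rw [hbd]; positivity
  set k := (σ * Real.sqrt (2 * Real.pi))⁻¹ with hk
  have i0 := aux_int_pow b hb 0
  have i1 := aux_int_pow b hb 1
  have i2 := aux_int_pow b hb 2
  have c0 := aux_int_cdf s⁻¹ _ i0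
  have c1 := aux_int_cdf s⁻¹ _ i1
  have c2 := aux_int_cdf s⁻¹ _ i2
  have e0 := aux_even s⁻¹ _ i0 (fun x => by simp)
  have e2 := aux_even s⁻¹ _ i2 (fun x => by simp)
  have e1 := aux_first b s⁻¹ hb
  rw [aux_second b hb, integral_gaussian] at e2
  simp only [pow_zero, one_mul] at e0 c0
  rw [integral_gaussian] at e0
  set I0 := ∫ x : ℝ, Real.exp (-b * x ^ 2) * stdGaussianCDF (s⁻¹ * x) with hI0
  set I1 := ∫ x : ℝ, (x ^ 1 * Real.exp (-b * x ^ 2)) * stdGaussianCDF (s⁻¹ * x) with hI1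
  set I2 := ∫ x : ℝ, (x ^ 2 * Real.exp (-b * x ^ 2)) * stdGaussianCDF (s⁻¹ * x) with hI2
  have hpdf : ∀ x, normalPDF μ σ x = k * Real.exp (-b * (x - μ) ^ 2) := by
    intro x; simp only [normalPDF, hk, hbd]; congr 2; field_simp
  have A1 : (∫ x, x * (2 * normalPDF μ σ x * stdGaussianCDF ((x - μ) / s)))
      = 2 * k * I1 + 2 * k * μ * I0 := by
    rw [← integral_add_right_eq_self _ μ, hI1, hI0, ← integral_const_mul, ← integral_const_mul,
      ← integral_add (c1.const_mul _) (c0.const_mul _)]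
    congr 1; ext x
    rw [hpdf, div_eq_inv_mul, add_sub_cancel_right]; ring
  have A2 : (∫ x, x ^ 2 * (2 * normalPDF μ σ x * stdGaussianCDF ((x - μ) / s)))
      = 2 * k * I2 + 4 * k * μ * I1 + 2 * k * μ ^ 2 * I0 := by
    have c21 : Integrable fun x : ℝ =>
        2 * k * (x ^ 2 * Real.exp (-b * x ^ 2) * stdGaussianCDF (s⁻¹ * x))
          + 4 * k * μ * (x ^ 1 * Real.exp (-b * x ^ 2) * stdGaussianCDF (s⁻¹ * x)) :=
      (c2.const_mul _).add (c1.const_mul _)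
    rw [← integral_add_right_eq_self _ μ, hI2, hI1, hI0, ← integral_const_mul, ← integral_const_mul, ← integral_const_mul,
      ← integral_add (c2.const_mul _) (c1.const_mul _),
      ← integral_add c21 (c0.const_mul _)]
    congr 1; ext x
    rw [hpdf, div_eq_inv_mul, add_sub_cancel_right]; ring
  have hq : Real.sqrt (Real.pi / b) = σ * Real.sqrt (2 * Real.pi) := by
    rw [hbd, div_inv_eq_mul, show Real.pi * (2 * σ ^ 2) = σ ^ 2 * (2 * Real.pi) by ring,
      Real.sqrt_mul (by positivity), Real.sqrt_sq hσ.le]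
  have hr : 0 < Real.sqrt (2 * Real.pi) := by positivity
  have hr2 : Real.sqrt (2 * Real.pi) ^ 2 = 2 * Real.pi := Real.sq_sqrt (by positivity)
  have hb' : (2 * b)⁻¹ = σ ^ 2 := by rw [hbd]; field_simp
  have B0 : 2 * k * I0 = 1 := by
    rw [hq] at e0
    have : k * (2 * I0) = 1 := by rw [e0, hk]; field_simp
    linarith
  have B2 : 2 * k * I2 = σ ^ 2 := by
    rw [hq, hb'] at e2
    have : k * (2 * I2) = σ ^ 2 := by rw [e2, hk]; field_simp
    linarith
  have B1 : (2 * k * I1) ^ 2 = σ ^ 2 * (2 * σ ^ 2 / (Real.pi * (2 * σ ^ 2 + ρ ^ 2))) := by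
    have hw : Real.sqrt (Real.pi / (b + s⁻¹ ^ 2 / 2)) ^ 2 = Real.pi / (b + s⁻¹ ^ 2 / 2) :=
      Real.sq_sqrt (by positivity)
    have hbs : Real.pi / (b + s⁻¹ ^ 2 / 2)
        = 2 * Real.pi * σ ^ 2 * s ^ 2 / (2 * σ ^ 2 + ρ ^ 2) := by
      have : b + s⁻¹ ^ 2 / 2 = (2 * σ ^ 2 + ρ ^ 2) / (2 * σ ^ 2 * s ^ 2) := by
        rw [hbd]; field_simp; rw [hs2]; ring
      rw [this]; field_simp
    rw [e1, hb', hk]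
    simp only [mul_pow, inv_pow, hr2] at hw hbs ⊢
    rw [hw, hbs]
    field_simp
    try ring
  rw [A1, A2]
  linear_combination (-1) * B1 + B2 + (-4 * k * I1 * μ - 2 * μ ^ 2 * k * I0) * B0
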